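/- arXiv:1410.5089 — 8 statements merged into one kernel-verified Lean document; each statement's English description precedes it below -/
import Mathlib

section
/- Let X be a finite type, and let L(G,T) be a loop with guard G : X → Prop and transition relation T : X → X → Prop. Then L is unconditionally terminating (there is no function f : ℕ → X with ∀ i, G (f i) ∧ T (f i) (f (i+1))) if and only if there exists a ranking function R : X → ℤ such that for all x x' : X, if G x and T x x' then 0 < R x and R x' < R x. -/
/-- **[UT]** For a loop L(G,T) over a finite state space X, unconditional
termination (no infinite execution) is equivalent to the existence of a
ranking function R : X → ℤ. -/
theorem unconditional_termination_iff_ranking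
    {X : Type*} [Finite X] (G : X → Prop) (T : X → X → Prop) :
    (¬ ∃ f : ℕ → X, ∀ i, G (f i) ∧ T (f i) (f (i + 1))) ↔
      ∃ R : X → ℤ, ∀ x x', G x → T x x' → 0 < R x ∧ R x' < R x := by
  constructor
  · intro h
    have wf : WellFounded (fun y x => G x ∧ T x y) := by
      rw [wellFounded_iff_isEmpty_descending_chain]
      exact ⟨fun f => h ⟨f.1, f.2⟩⟩
    refine ⟨fun x => ({y | Relation.TransGen (fun y x => G x ∧ T x y) y x}.ncard : ℤ), ?_⟩
    intro x x' hG hT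
    have hx : Relation.TransGen (fun y x => G x ∧ T x y) x' x := .single ⟨hG, hT⟩
    have hlt : {y | Relation.TransGen (fun y x => G x ∧ T x y) y x'}.ncard <
        {y | Relation.TransGen (fun y x => G x ∧ T x y) y x}.ncard := by
      apply Set.ncard_lt_ncard _ (Set.toFinite _)
      refine ⟨fun y hy => Relation.TransGen.trans hy hx, fun hs => ?_⟩
      have h1 : Relation.TransGen (fun y x => G x ∧ T x y) x' x' := hs hx
      exact wf.transGen.irrefl.irrefl x' h1
    dsimp only
    omega
  · rintro ⟨R, hR⟩ ⟨f, hf⟩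
    have key : ∀ n : ℕ, R (f n) + n ≤ R (f 0) := by
      intro n
      induction n with
      | zero => simp
      | succ k ih =>
        have := (hR _ _ (hf k).1 (hf k).2).2
        push_cast
        omega
    have h1 := key (R (f 0)).toNat
    have h2 := (hR _ _ (hf (R (f 0)).toNat).1 (hf (R (f 0)).toNat).2).1
    omega
end

section
/- Let X be a type and L(G,T) a loop with guard G : X → Prop and transition relation T : X → X → Prop. Then L has an infinite execution (there exists f : ℕ → X with ∀ i, G (f i) ∧ T (f i) (f (i+1))) if and only if there exists an open recurrence set, i.e. a predicate N : X → Prop and a state x₀ : X such that N x₀, (∀ x, N x → G x), and (∀ x, N x → ∃ x', T x x' ∧ N x'). -/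
/-- **[ONT]** A loop L(G,T) has an infinite execution iff there exists an
open recurrence set. -/
theorem infinite_execution_iff_open_recurrence_set
    {X : Type*} (G : X → Prop) (T : X → X → Prop) :
    (∃ f : ℕ → X, ∀ i, G (f i) ∧ T (f i) (f (i + 1))) ↔
      ∃ (N : X → Prop) (x₀ : X), N x₀ ∧ (∀ x, N x → G x) ∧
        (∀ x, N x → ∃ x', T x x' ∧ N x') := by
  constructor
  · rintro ⟨f, hf⟩
    refine ⟨fun x => ∃ i, f i = x, f 0, ⟨0, rfl⟩, ?_, ?_⟩
    · rintro x ⟨i, rfl⟩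
      exact (hf i).1
    · rintro x ⟨i, rfl⟩
      exact ⟨f (i + 1), (hf i).2, i + 1, rfl⟩
  · rintro ⟨N, x₀, h0, hG, hT⟩
    choose g hg using hT
    let s : ℕ → {x // N x} := fun n =>
      Nat.rec ⟨x₀, h0⟩ (fun _ p => ⟨g p.1 p.2, (hg p.1 p.2).2⟩) n
    exact ⟨fun n => (s n).1, fun i => ⟨hG _ (s i).2, (hg (s i).1 (s i).2).1⟩⟩
end

section
/- Let X be a finite type, G : X → Prop, T : X → X → Prop, and I : X → Prop a set of initial states. Then the loop L(G,T) terminates from every state satisfying I (there is no f : ℕ → X with I (f 0) and ∀ i, G (f i) ∧ T (f i) (f (i+1))) if and only if there exist R : X → ℤ and a supporting invariant W : X → Prop such that (∀ x, I x → G x → W x) and (∀ x x', G x → W x → T x x' → W x' ∧ 0 < R x ∧ R x' < R x). -/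
/-- **[CT]** For a loop L(G,T) over a finite state space with initial states
I, termination from every initial state is equivalent to the existence of a
ranking function R together with a supporting invariant W. -/
theorem conditional_termination_iff
    {X : Type*} [Finite X] (G : X → Prop) (T : X → X → Prop) (I : X → Prop) :
    (¬ ∃ f : ℕ → X, I (f 0) ∧ ∀ i, G (f i) ∧ T (f i) (f (i + 1))) ↔
      ∃ (R : X → ℤ) (W : X → Prop),
        (∀ x, I x → G x → W x) ∧
        (∀ x x', G x → W x → T x x' → W x' ∧ 0 < R x ∧ R x' < R x) := by
  constructor
  · intro h
    let S : X → X → Prop := fun a b => G a ∧ T a b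
    refine ⟨fun x => ({y | Relation.TransGen S x y}.ncard : ℤ),
      fun x => ¬ ∃ f : ℕ → X, f 0 = x ∧ ∀ i, S (f i) (f (i + 1)), ?_, ?_⟩
    · rintro x hI - ⟨f, rfl, hf⟩
      exact h ⟨f, hI, hf⟩
    · intro x x' hG hW hT
      have hS : S x x' := ⟨hG, hT⟩
      have hW' : ¬ ∃ f : ℕ → X, f 0 = x' ∧ ∀ i, S (f i) (f (i + 1)) := by
        rintro ⟨f, h0, hf⟩
        refine hW ⟨fun n => Nat.casesOn n x f, rfl, ?_⟩
        intro i
        cases i with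
        | zero => simpa [h0] using hS
        | succ k => exact hf k
      have hcyc : ¬ Relation.TransGen S x' x' := by
        intro hc
        have step : ∀ y : {y // Relation.TransGen S y x'},
            ∃ z : {y // Relation.TransGen S y x'}, S y.1 z.1 := by
          rintro ⟨y, hy⟩
          rcases Relation.TransGen.head'_iff.1 hy with ⟨z, hyz, hz⟩
          rcases Relation.reflTransGen_iff_eq_or_transGen.1 hz with e | ht
          · subst e
            exact ⟨⟨_, hc⟩, hyz⟩
          · exact ⟨⟨z, ht⟩, hyz⟩
        choose g hg using step
        refine hW' ⟨fun n => (g^[n] ⟨x', hc⟩).1, rfl, fun i => ?_⟩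
        simp only [Function.iterate_succ_apply']
        exact hg _
      have hlt : {y | Relation.TransGen S x' y}.ncard < {y | Relation.TransGen S x y}.ncard := by
        apply Set.ncard_lt_ncard _ (Set.toFinite _)
        refine ⟨fun y hy => Relation.TransGen.head hS hy, fun hsub => hcyc ?_⟩
        exact hsub (Relation.TransGen.single hS)
      refine ⟨hW', ?_, ?_⟩
      · dsimp only
        omega
      · dsimp only
        omega
  · rintro ⟨R, W, hI, hW⟩ ⟨f, h0, hf⟩
    have hWf : ∀ i, W (f i) := by
      intro i
      induction i with
      | zero => exact hI _ h0 (hf 0).1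
      | succ k ih => exact (hW _ _ (hf k).1 ih (hf k).2).1
    have hR : ∀ i : ℕ, R (f i) ≤ R (f 0) - i := by
      intro i
      induction i with
      | zero => simp
      | succ k ih =>
        have := (hW _ _ (hf k).1 (hWf k) (hf k).2).2.2
        push_cast
        omega
    have h1 := hR (R (f 0)).toNat
    have h2 := (hW _ _ (hf (R (f 0)).toNat).1 (hWf _) (hf _).2).2.1
    omega
end

section
/- Let X be a finite type, G : X → Prop and T : X → X → Prop. Then at least one of the following holds: (1) there exists R : X → ℤ such that for all x x', G x → T x x' → 0 < R x ∧ R x' < R x; or (2) there exist N : X → Prop, C : X → X, and x₀ : X such that N x₀, (∀ x, N x → G x), and (∀ x, N x → T x (C x) ∧ N (C x)). -/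
/-- **[GT]** The generalised termination formula is a tautology over finite
state spaces: either a ranking function or a Skolemized open recurrence set
exists. -/
theorem generalised_termination
    {X : Type*} [Finite X] (G : X → Prop) (T : X → X → Prop) :
    (∃ R : X → ℤ, ∀ x x', G x → T x x' → 0 < R x ∧ R x' < R x) ∨
      ∃ (N : X → Prop) (C : X → X) (x₀ : X), N x₀ ∧ (∀ x, N x → G x) ∧
        (∀ x, N x → T x (C x) ∧ N (C x)) := by
  classical
  let r : X → X → Prop := fun y x => G x ∧ T x y
  by_cases hwf : WellFounded r
  · left
    refine ⟨fun x => (({y | Relation.TransGen r y x} : Set X).ncard : ℤ), ?_⟩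
    intro x x' hG hT
    have hr : r x' x := ⟨hG, hT⟩
    have hlt : ({y | Relation.TransGen r y x'} : Set X).ncard <
        ({y | Relation.TransGen r y x} : Set X).ncard := by
      apply Set.ncard_lt_ncard _ (Set.toFinite _)
      refine ⟨fun y hy => Relation.TransGen.tail hy hr, fun h => ?_⟩
      have h1 : Relation.TransGen r x' x' := h (Relation.TransGen.single hr)
      exact hwf.transGen.irrefl.irrefl x' h1
    refine ⟨?_, ?_⟩
    · beta_reduce
      exact_mod_cast lt_of_le_of_lt (Nat.zero_le _) hlt
    · beta_reduce
      exact_mod_cast hlt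
  · right
    have step : ∀ x, ¬ Acc r x → ∃ y, r y x ∧ ¬ Acc r y := by
      intro x hx
      by_contra hcon
      exact hx ⟨x, fun y hy => by_contra fun hn => hcon ⟨y, hy, hn⟩⟩
    have hx0 : ∃ x, ¬ Acc r x := by
      by_contra hcon
      exact hwf ⟨fun x => by_contra fun hn => hcon ⟨x, hn⟩⟩
    obtain ⟨x₀, h0⟩ := hx0
    refine ⟨fun x => ¬ Acc r x, fun x => if h : ¬ Acc r x then (step x h).choose else x,
      x₀, h0, fun x hx => ?_, fun x hx => ?_⟩
    · obtain ⟨y, hy, _⟩ := step x hx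
      exact hy.1
    · have hs := (step x hx).choose_spec
      simp only [dif_pos hx]
      exact ⟨hs.1.2, hs.2⟩
end

section
/- For every width w and every bit-vector x : BitVec w with x ≠ 0, the result of clearing the lowest set bit is strictly smaller as an unsigned value: ((x - 1) &&& x).toNat < x.toNat. -/
/-- Clearing the lowest set bit strictly decreases the unsigned value:
R(x) = x is a ranking function for `while (x > 0) { x = (x - 1) & x; }`. -/
theorem clear_lowest_bit_lt (w : ℕ) (x : BitVec w) (hx : x ≠ 0) :
    ((x - 1) &&& x).toNat < x.toNat := by
  have hpos : 0 < x.toNat := by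
    rcases Nat.eq_zero_or_pos x.toNat with h | h
    · exact absurd (BitVec.eq_of_toNat_eq (by simpa using h)) hx
    · exact h
  have hlt : x.toNat < 2 ^ w := x.isLt
  have h1 : (1 : BitVec w).toNat = 1 := by
    change 1 % 2 ^ w = 1
    exact Nat.mod_eq_of_lt (by omega)
  have hs : (x - 1).toNat = x.toNat - 1 := by
    rw [BitVec.toNat_sub, h1]
    have : 2 ^ w - 1 + x.toNat = (x.toNat - 1) + 2 ^ w := by omega
    rw [this, Nat.add_mod_right]
    exact Nat.mod_eq_of_lt (by omega)
  rw [BitVec.toNat_and, hs]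
  have := Nat.and_le_left (n := x.toNat - 1) (m := x.toNat)
  omega
end

section
/- For every width w and every bit-vector x : BitVec w with x ≠ 0, the absolute value of the signed interpretation strictly decreases under one iteration of the loop body 'if (x > 0) x--; else x++;': (if (0#w).slt x then x - 1 else x + 1).toInt.natAbs < x.toInt.natAbs. -/
theorem abs_decreases_branch (w : ℕ) (x : BitVec w) (hx : x ≠ 0) :
    (if (0#w).slt x then x - 1 else x + 1).toInt.natAbs < x.toInt.natAbs := by
  have h0 : x.toNat ≠ 0 := by
    intro h
    apply hx
    apply BitVec.eq_of_toNat_eq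
    simpa using h
  have hlt := x.isLt
  cases w with
  | zero => simp at hlt; omega
  | succ n =>
    have hk : 0 < 2 ^ n := by positivity
    have h1 : (1 : BitVec (n+1)).toNat = 1 := by
      change (1#(n+1)).toNat = 1
      rw [BitVec.toNat_ofNat]
      apply Nat.mod_eq_of_lt
      rw [pow_succ]; omega
    have hz : (0#(n+1)).toInt = 0 := by simp
    rw [pow_succ] at hlt
    generalize hK : 2 ^ n = k at *
    have hKz : (2 : ℤ) ^ n = k := by rw [← hK]; push_cast; rfl
    split_ifs with h
    · rw [BitVec.slt_iff_toInt_lt, hz, BitVec.toInt_eq_toNat_cond] at h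
      rw [BitVec.toInt_eq_toNat_cond, BitVec.toInt_eq_toNat_cond, BitVec.toNat_sub, h1]
      simp only [pow_succ, hK] at h ⊢
      have hp : 2 * x.toNat < k * 2 := by
        by_contra hc
        rw [if_neg hc] at h
        push_cast at h; omega
      have e : (k * 2 - 1 + x.toNat) % (k * 2) = x.toNat - 1 := by
        rw [show k * 2 - 1 + x.toNat = (x.toNat - 1) + k * 2 by omega, Nat.add_mod_right]
        exact Nat.mod_eq_of_lt (by omega)
      rw [e, if_pos hp, if_pos (by omega)]
      omega
    · rw [BitVec.slt_iff_toInt_lt, hz, BitVec.toInt_eq_toNat_cond] at h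
      rw [BitVec.toInt_eq_toNat_cond, BitVec.toInt_eq_toNat_cond, BitVec.toNat_add, h1]
      simp only [pow_succ, hK] at h ⊢
      have hp : ¬ 2 * x.toNat < k * 2 := by
        intro hc
        rw [if_pos hc] at h
        omega
      rw [if_neg hp]
      by_cases hl : x.toNat + 1 = k * 2
      · rw [hl, Nat.mod_self, if_pos (by omega)]
        push_cast; omega
      · rw [Nat.mod_eq_of_lt (by omega), if_neg (by omega)]
        push_cast; omega
end

section
/- For every width w, the loop 'while (x > 0) { x = x - y; }' over signed w-bit machine integers terminates from every initial state satisfying y = 1: there is no function f : ℕ → BitVec w × BitVec w such that (f 0).2 = 1#w and, for all n, (0#w).slt (f n).1 and f (n+1) = ((f n).1 - (f n).2, (f n).2). -/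
/-- Conditional termination: the loop `while (x > 0) { x = x - y; }` over
signed w-bit machine integers terminates from every initial state with
y = 1. -/
theorem conditional_termination_sub_loop (w : ℕ) :
    ¬ ∃ f : ℕ → BitVec w × BitVec w,
      (f 0).2 = 1#w ∧
      ∀ n, (0#w).slt (f n).1 ∧ f (n + 1) = ((f n).1 - (f n).2, (f n).2) := by
  rintro ⟨f, h0, h⟩
  have key : ∀ n, (f n).2 = 1#w ∧ (f n).1 = (f 0).1 - BitVec.ofNat w n := by
    intro n
    induction n with
    | zero => exact ⟨h0, by simp⟩
    | succ k ih =>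
      obtain ⟨h2, h1⟩ := ih
      rw [(h k).2]
      refine ⟨h2, ?_⟩
      show (f k).1 - (f k).2 = _
      rw [h1, h2, BitVec.ofNat_add, BitVec.sub_sub]
  have hz := (h (f 0).1.toNat).1
  rw [(key _).2] at hz
  simp [BitVec.slt] at hz
end

section
/- The nondeterministic loop 'while (x > 0 && y > 0 && z > 0) { if (y > x) { y = z; x = nondet(); z = x - 1; } else { z = z - 1; x = nondet(); y = x - 1; } }' over the mathematical integers terminates: there is no function f : ℕ → ℤ × ℤ × ℤ such that for all n, writing (x, y, z) = f n and (x', y', z') = f (n+1), we have x > 0 ∧ y > 0 ∧ z > 0, and if y > x then y' = z ∧ z' = x' - 1 (with x' unconstrained), while if y ≤ x then z' = z - 1 ∧ y' = x' - 1 (with x' unconstrained). -/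
/-- The nondeterministic loop
`while (x > 0 && y > 0 && z > 0) { if (y > x) { y = z; x = nondet(); z = x - 1; }
else { z = z - 1; x = nondet(); y = x - 1; } }`
over the mathematical integers terminates. -/
theorem nondet_loop_terminates :
    ¬ ∃ f : ℕ → ℤ × ℤ × ℤ, ∀ n,
      ((f n).1 > 0 ∧ (f n).2.1 > 0 ∧ (f n).2.2 > 0) ∧
      ((f n).2.1 > (f n).1 →
        (f (n + 1)).2.1 = (f n).2.2 ∧ (f (n + 1)).2.2 = (f (n + 1)).1 - 1) ∧
      ((f n).2.1 ≤ (f n).1 →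
        (f (n + 1)).2.2 = (f n).2.2 - 1 ∧ (f (n + 1)).2.1 = (f (n + 1)).1 - 1) := by
  rintro ⟨f, hf⟩
  -- once `y ≤ x` holds it persists and `z` decreases
  have h1 : ∀ n, (f n).1 < (f n).2.1 := by
    intro n
    by_contra hn
    have key : ∀ k : ℕ, (f (n + k)).2.1 ≤ (f (n + k)).1 ∧
        (f (n + k)).2.2 = (f n).2.2 - k := by
      intro k
      induction k with
      | zero => simpa using hn
      | succ k ih =>
        obtain ⟨a, b⟩ := (hf (n + k)).2.2 ih.1
        rw [← Nat.add_assoc]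
        push_cast
        omega
    have h := (key (f n).2.2.toNat).2
    have hp := (hf (n + (f n).2.2.toNat)).1.2.2
    have hq := (hf n).1.2.2
    omega
  -- hence `y > x` always, and `z` decreases again
  have h2 : ∀ k : ℕ, (f k).2.2 ≤ (f 0).2.2 - k := by
    intro k
    induction k with
    | zero => simp
    | succ k ih =>
      obtain ⟨a, b⟩ := (hf k).2.1 (h1 k)
      have := h1 (k + 1)
      push_cast
      omega
  have h := h2 (f 0).2.2.toNat
  have hp := (hf (f 0).2.2.toNat).1.2.2
  have hq := (hf 0).1.2.2
  omega
end
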